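/- arXiv:2108.09839 — 4 statements merged into one kernel-verified Lean document; each statement's English description precedes it below -/
import Mathlib

section
/- Let f : X → Y be a quotient map of topological spaces. If X is g-stable, then Y is g-stable. -/
open Filter Topology Set

universe u v

/-- A subadditive measure on a set `A`. -/
def IsSubadditiveMeasure {A : Type*} (p : Set A → ℝ) : Prop :=
  (∀ B : Set A, 0 ≤ p B ∧ p B ≤ 1) ∧
  (∀ B C : Set A, Disjoint B C → p (B ∪ C) ≤ p B + p C) ∧
  (∀ S : ℕ → Set A, (∀ n, S (n + 1) ⊆ S n) → (⋂ n, S n) = ∅ →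
    Tendsto (fun n => p (S n)) atTop (𝓝 0))

/-- The g-modification of a topology `t`. -/
def gMod {X : Type u} (t : TopologicalSpace X) : TopologicalSpace X :=
  TopologicalSpace.generateFrom
    {W : Set X | ∃ (A : Type u) (U : A → Set X) (p : Set A → ℝ) (ε : ℝ),
      (∀ α, IsOpen[t] (U α)) ∧ IsSubadditiveMeasure p ∧ 0 < ε ∧
      W = {x : X | p {α : A | x ∉ U α} < ε}}

/-- A topological space is g-stable if its topology coincides with its g-modification. -/
def GStable {X : Type u} (t : TopologicalSpace X) : Prop := gMod t = t

/-- The image of a subadditive measure under a map of index sets is a subadditive measure. -/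
theorem IsSubadditiveMeasure.map {A B : Type*} {p : Set A → ℝ} (hp : IsSubadditiveMeasure p)
    (g : A → B) : IsSubadditiveMeasure fun S : Set B => p (g ⁻¹' S) := by
  obtain ⟨bounds, subadd, cont⟩ := hp
  refine ⟨fun S => bounds _, fun S T hST => subadd _ _ (hST.preimage g), fun S hS hempty => ?_⟩
  refine cont (fun n => g ⁻¹' S n) (fun n => preimage_mono (hS n)) ?_
  rw [← preimage_iInter, hempty, preimage_empty]

open Classical in
/-- The Dirac measure at a point is a subadditive measure. -/
theorem isSubadditiveMeasure_dirac {A : Type*} (a : A) :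
    IsSubadditiveMeasure fun B : Set A => if a ∈ B then (1 : ℝ) else 0 := by
  refine ⟨fun B => by dsimp only; split_ifs <;> norm_num, fun B C _ => ?_, fun S hS hempty => ?_⟩
  · by_cases hB : a ∈ B <;> by_cases hC : a ∈ C <;> simp [hB, hC]
  · obtain ⟨n, hn⟩ : ∃ n, a ∉ S n := by
      by_contra! h
      exact (hempty ▸ mem_iInter.2 h : a ∈ (∅ : Set A))
    refine tendsto_const_nhds.congr' ?_
    filter_upwards [eventually_ge_atTop n] with m hm
    exact (if_neg fun h => hn (antitone_nat_of_succ_le hS hm h)).symm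

/-- The g-modification of a topology refines it. -/
theorem gMod_le {X : Type u} (t : TopologicalSpace X) : gMod t ≤ t := by
  classical
  intro V hV
  refine TopologicalSpace.isOpen_generateFrom_of_mem
    ⟨PUnit, fun _ => V, _, 1, fun _ => hV, isSubadditiveMeasure_dirac PUnit.unit, one_pos, ?_⟩
  ext x
  by_cases hx : x ∈ V <;> simp [hx]

/-- In a g-stable space the basic sets of the g-modification are open, for families of open sets
indexed by a type in any universe. -/
theorem GStable.isOpen_setOf_lt {X : Type u} {t : TopologicalSpace X} (ht : GStable t)
    {A : Type v} {U : A → Set X} {p : Set A → ℝ} {ε : ℝ} (hU : ∀ α, IsOpen[t] (U α))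
    (hp : IsSubadditiveMeasure p) (hε : 0 < ε) :
    IsOpen[t] {x | p {α | x ∉ U α} < ε} := by
  have h : IsOpen[gMod t] {x | p {α | x ∉ U α} < ε} := by
    refine TopologicalSpace.isOpen_generateFrom_of_mem
      ⟨Set X, fun s => interior s, _, ε, fun s => isOpen_interior, hp.map U, hε, ?_⟩
    simp only [preimage_ofPred_eq, (hU _).interior_eq]
  rwa [ht] at h

/-- if `f : X → Y` is a quotient map and `X` is g-stable, then `Y` is g-stable. -/
theorem gStable_of_quotientMap {X : Type u} {Y : Type v} [tX : TopologicalSpace X]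
    [tY : TopologicalSpace Y] (f : X → Y) (hf : IsQuotientMap f) (hX : GStable tX) :
    GStable tY := by
  refine le_antisymm (gMod_le tY) (le_generateFrom ?_)
  rintro W ⟨A, U, p, ε, hU, hp, hε, rfl⟩
  rw [← hf.isOpen_preimage]
  exact hX.isOpen_setOf_lt (fun α => (hU α).preimage hf.continuous) hp hε
end

section
/- Let (X, 𝒯) be a topological space and let 𝒯_m be the m-modification of 𝒯. Then 𝒯 and 𝒯_m induce the same subspace topology on every subset of X of non-Ulam-measurable cardinality; in particular, if Card(X) is non-Ulam-measurable, then 𝒯_m = 𝒯. -/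
open Filter Topology Set

universe u

/-- An ultrafilter is ω₁-complete (countably complete) if it is closed under countable
intersections. -/
def CountablyComplete {A : Type*} (p : Ultrafilter A) : Prop :=
  ∀ S : ℕ → Set A, (∀ n, S n ∈ p) → (⋂ n, S n) ∈ p

/-- `Card(A)` is Ulam-measurable: there is a free (containing no finite set) ω₁-complete
ultrafilter on `A`. -/
def UlamMeasurableType (A : Type*) : Prop :=
  ∃ p : Ultrafilter A, (∀ F : Set A, F.Finite → F ∉ p) ∧ CountablyComplete p

/-- The m-modification of a topology `t`: the topology generated by the sets
`W(𝒮, p) = {x | {α | x ∈ U α} ∈ p}` for families `𝒮 = {U α}` of `t`-open sets and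
ω₁-complete ultrafilters `p` on the index set. -/
def mMod {X : Type u} (t : TopologicalSpace X) : TopologicalSpace X :=
  TopologicalSpace.generateFrom
    {W : Set X | ∃ (A : Type u) (U : A → Set X) (p : Ultrafilter A),
      (∀ α, IsOpen[t] (U α)) ∧ CountablyComplete p ∧
      W = {x : X | {α : A | x ∈ U α} ∈ p}}

theorem CountablyComplete.map {A B : Type*} {p : Ultrafilter A} (hp : CountablyComplete p)
    (f : A → B) : CountablyComplete (p.map f) := fun S hS => by
  rw [Ultrafilter.mem_map, preimage_iInter]
  exact hp _ hS

/-- A countably complete ultrafilter on the index set of a family of subsets of a type of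
non-Ulam-measurable cardinality concentrates on the indices of a single subset. -/
theorem CountablyComplete.setOf_eq_limit_mem {A Y : Type*} {p : Ultrafilter A}
    (hp : CountablyComplete p) (hY : ¬ UlamMeasurableType Y) (V : A → Set Y) :
    {α | V α = {y | {β | y ∈ V β} ∈ p}} ∈ p := by
  set L : Set Y := {y | {β | y ∈ V β} ∈ p}
  have agree (y : Y) : {α | y ∈ V α ↔ y ∈ L} ∈ p := by
    by_cases hy : y ∈ L
    · exact mem_of_superset hy fun α hα => iff_of_true hα hy
    · exact mem_of_superset (Ultrafilter.compl_mem_iff_notMem.2 hy) fun α hα => iff_of_false hα hy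
  by_contra hne
  have differ : {α | V α ≠ L} ∈ p := Ultrafilter.compl_mem_iff_notMem.2 hne
  have separated (α : A) (hα : V α ≠ L) : ∃ y, ¬ (y ∈ V α ↔ y ∈ L) := by
    by_contra! h
    exact hα (Set.ext h)
  obtain ⟨α₀, hα₀⟩ := p.nonempty_of_mem differ
  have : Nonempty Y := ⟨(separated α₀ hα₀).choose⟩
  choose! f hf using separated
  have : ∃ F : Set Y, F.Finite ∧ F ∈ p.map f := by
    by_contra! h
    exact hY ⟨p.map f, h, hp.map f⟩
  obtain ⟨F, hF, hFp⟩ := this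
  have agree_on_F : (⋂ y ∈ F, {α | y ∈ V α ↔ y ∈ L}) ∈ p :=
    (biInter_mem hF).2 fun y _ => agree y
  obtain ⟨α, ⟨hαF, hα⟩, hαL⟩ :=
    p.nonempty_of_mem (inter_mem (inter_mem agree_on_F (Ultrafilter.mem_map.1 hFp)) differ)
  exact hf α hαL (mem_iInter₂.1 hαF (f α) hα)

theorem mMod_le {X : Type u} (t : TopologicalSpace X) : mMod t ≤ t := by
  intro U hU
  refine TopologicalSpace.isOpen_generateFrom_of_mem
    ⟨PUnit, fun _ => U, pure PUnit.unit, fun _ => hU, fun S hS => ?_, ?_⟩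
  · simpa [Ultrafilter.mem_pure] using hS
  · ext x
    simp [Ultrafilter.mem_pure]

/-- Maps out of a type of non-Ulam-measurable cardinality induce the same topology from a
topology and from its m-modification. -/
theorem induced_mMod {X : Type u} {Y : Type*} (t : TopologicalSpace X)
    (hY : ¬ UlamMeasurableType Y) (f : Y → X) :
    TopologicalSpace.induced f (mMod t) = TopologicalSpace.induced f t := by
  refine le_antisymm (induced_mono (mMod_le t)) ?_
  rw [mMod, induced_generateFrom_eq]
  refine le_generateFrom ?_
  rintro _ ⟨_, ⟨A, U, p, hU, hp, rfl⟩, rfl⟩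
  obtain ⟨α, hα⟩ := p.nonempty_of_mem (hp.setOf_eq_limit_mem hY fun α => f ⁻¹' U α)
  exact ⟨U α, hU α, hα⟩

/-- the topologies `𝒯` and `𝒯_m` induce the same subspace topology on every
subset of non-Ulam-measurable cardinality; in particular if `Card(X)` is non-Ulam-measurable
then `𝒯_m = 𝒯`. -/
theorem mMod_agrees_on_small_sets {X : Type u} (t : TopologicalSpace X) :
    (∀ S : Set X, ¬ UlamMeasurableType ↥S →
      TopologicalSpace.induced (Subtype.val : S → X) (mMod t) =
        TopologicalSpace.induced (Subtype.val : S → X) t) ∧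
    (¬ UlamMeasurableType X → mMod t = t) := by
  refine ⟨fun S hS => induced_mMod t hS Subtype.val, fun hX => ?_⟩
  simpa only [induced_id] using induced_mMod t hX id
end

section
/- Let {X_α : α ∈ A} be a family of bi-sequential topological spaces and let X = ∏_{α ∈ A} X_α with the product topology. If the cardinal Card(A) is non-Ulam-measurable, then X has countable functional tightness. -/
open Filter Topology Set

universe u

/-- A topological space `X` is bi-sequential if every ultrafilter converging to a point `x`
contains a filter with a countable base converging to `x`. -/
def BiSequential (X : Type*) [TopologicalSpace X] : Prop :=
  ∀ (x : X) (𝒰 : Ultrafilter X), (𝒰 : Filter X) ≤ 𝓝 x →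
    ∃ F : Filter X, F.IsCountablyGenerated ∧ (𝒰 : Filter X) ≤ F ∧ F ≤ 𝓝 x

/-- A space has countable functional tightness if every ω-continuous real-valued function
(i.e. one whose restriction to every countable subspace is continuous) is continuous. -/
def CountableFunctionalTightness (X : Type*) [TopologicalSpace X] : Prop :=
  ∀ f : X → ℝ, (∀ S : Set X, S.Countable → Continuous fun x : S => f x) → Continuous f

/-- An ω-continuous function is continuous along every convergent filter that contains a
countable set. -/
theorem tendsto_of_countable_mem {X : Type*} [TopologicalSpace X] {f : X → ℝ}
    (hf : ∀ S : Set X, S.Countable → Continuous fun x : S => f x) {x : X} {p : Filter X}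
    {S : Set X} (hS : S.Countable) (hSp : S ∈ p) (hp : p ≤ 𝓝 x) : Tendsto f p (𝓝 (f x)) := by
  have h1 : ContinuousOn f (insert x S) :=
    continuousOn_iff_continuous_domRestrict.2 (hf _ (hS.insert x))
  have h2 : Tendsto f (𝓝[insert x S] x) (𝓝 (f x)) := h1 x (mem_insert x S)
  refine h2.mono_left ?_
  rw [nhdsWithin]
  exact le_inf hp (le_principal_iff.2 (mem_of_superset hSp (subset_insert x S)))

/-- A real function on the power set of `A`, viewed as the Cantor cube, is ω-continuous when it is
continuous along every convergent filter that contains a countable family. -/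
def OmegaContinuousSetFun {A : Type*} (g : Set A → ℝ) : Prop :=
  ∀ (p : Filter (Set A)) (C : Set (Set A)) (S : Set A), C.Countable → C ∈ p →
    (∀ a, ∀ᶠ T in p, (a ∈ T ↔ a ∈ S)) → Tendsto g p (𝓝 (g S))

namespace OmegaContinuousSetFun

variable {A K : Type*} {g : Set A → ℝ}

theorem comp_preimage (hg : OmegaContinuousSetFun g) (φ : A → K) :
    OmegaContinuousSetFun fun T : Set K => g (φ ⁻¹' T) := by
  intro p C S hC hCp hS
  have := hg (p.map (preimage φ)) (preimage φ '' C) (φ ⁻¹' S) (hC.image _)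
    (image_mem_map hCp) (fun a => by simpa using hS (φ a))
  exact this

/-- If a countable family accumulates at `S`, then its values accumulate at the value at `S`. -/
theorem exists_abs_sub_lt (hg : OmegaContinuousSetFun g) {C : Set (Set A)} (hC : C.Countable)
    {S : Set A} (h : ∀ J : Finset A, ∃ T ∈ C, ∀ a ∈ J, (a ∈ T ↔ a ∈ S)) {ε : ℝ} (hε : 0 < ε) :
    ∃ T ∈ C, |g T - g S| < ε := by
  choose t htC ht using h
  have h1 := hg (map t atTop) C S hC (mem_map.2 (Eventually.of_forall htC)) (fun a => by
    rw [eventually_map]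
    filter_upwards [eventually_ge_atTop {a}] with J hJ
    exact ht J a (hJ (Finset.mem_singleton_self a)))
  have h2 := (tendsto_map'_iff.1 h1).eventually (Metric.ball_mem_nhds _ hε)
  obtain ⟨J, hJ⟩ := h2.exists
  exact ⟨t J, htC J, by simpa [Real.dist_eq] using hJ⟩

/-- In a disjoint sequence of sets, some member has oscillation at most `ε`. -/
theorem exists_small_of_disjoint (hg : OmegaContinuousSetFun g) {ε : ℝ} (hε : 0 < ε)
    (E : ℕ → Set A) (hE : Pairwise (Function.onFun Disjoint E)) :
    ∃ n, ∀ T T' : Set A, (∀ a ∉ E n, (a ∈ T ↔ a ∈ T')) → |g T - g T'| ≤ ε := by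
  by_contra! h
  choose T T' hT hlt using h
  let S : Set A := {a | ∀ᶠ n in (hyperfilter ℕ : Filter ℕ), a ∈ T n}
  have h1 : ∀ a, ∀ᶠ n in (hyperfilter ℕ : Filter ℕ), (a ∈ T n ↔ a ∈ S) := by
    intro a
    by_cases ha : a ∈ S
    · have ha' : ∀ᶠ n in (hyperfilter ℕ : Filter ℕ), a ∈ T n := ha
      filter_upwards [ha'] with n hn using by simp [hn, ha]
    · have ha' : ∀ᶠ n in (hyperfilter ℕ : Filter ℕ), a ∉ T n := Ultrafilter.eventually_not.2 ha
      filter_upwards [ha'] with n hn using by simp [hn, ha]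
  have h2 : ∀ a, ∀ᶠ n in (hyperfilter ℕ : Filter ℕ), (a ∈ T' n ↔ a ∈ S) := by
    intro a
    have hsub : {n | a ∈ E n}.Subsingleton := by
      intro m hm n hn
      by_contra hmn
      exact (Set.disjoint_left.1 (hE hmn)) hm hn
    have h3 : ∀ᶠ n in (hyperfilter ℕ : Filter ℕ), a ∉ E n :=
      compl_mem_hyperfilter_of_finite hsub.finite
    filter_upwards [h1 a, h3] with n hn hn'
    rw [← hT n a hn', hn]
  have key : ∀ u : ℕ → Set A, (∀ a, ∀ᶠ n in (hyperfilter ℕ : Filter ℕ), (a ∈ u n ↔ a ∈ S)) →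
      Tendsto (fun n => g (u n)) (hyperfilter ℕ : Filter ℕ) (𝓝 (g S)) := fun u hu =>
    tendsto_map'_iff.1 (hg (map u (hyperfilter ℕ : Filter ℕ)) (range u) S (countable_range u)
      range_mem_map hu)
  have h4 := ((key T h1).sub (key T' h2)).abs
  rw [sub_self, abs_zero] at h4
  obtain ⟨n, hn⟩ := (h4.eventually (gt_mem_nhds hε)).exists
  exact absurd hn (hlt n).le.not_gt

end OmegaContinuousSetFun

/-- On an index set of non-Ulam-measurable cardinality, if a class of sets contains the
subsingletons and meets every disjoint sequence, then countably many members cover. -/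
theorem exists_countable_cover_of_not_ulamMeasurable {A : Type*} (hA : ¬ UlamMeasurableType A)
    (P : Set A → Prop) (hP : ∀ S : Set A, S.Subsingleton → P S)
    (hdisj : ∀ E : ℕ → Set A, Pairwise (Function.onFun Disjoint E) → ∃ n, P (E n)) :
    ∃ c : ℕ → Set A, (∀ a, ∃ n, a ∈ c n) ∧ ∀ n, P (c n) := by
  let J : Set A → Prop := fun E => ∃ c : ℕ → Set A, E ⊆ ⋃ n, c n ∧ ∀ n, P (c n)
  have J_mono : ∀ {E F : Set A}, E ⊆ F → J F → J E := fun h ⟨c, hc, hcP⟩ => ⟨c, h.trans hc, hcP⟩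
  have J_of : ∀ {E : Set A}, P E → J E := fun {E} h =>
    ⟨fun _ => E, fun a ha => mem_iUnion.2 ⟨0, ha⟩, fun _ => h⟩
  have J_iUnion : ∀ E : ℕ → Set A, (∀ n, J (E n)) → J (⋃ n, E n) := by
    intro E h
    choose c hc hcP using h
    refine ⟨fun n => c n.unpair.1 n.unpair.2, ?_, fun n => hcP _ _⟩
    intro a ha
    obtain ⟨i, hi⟩ := mem_iUnion.1 ha
    obtain ⟨j, hj⟩ := mem_iUnion.1 (hc i hi)
    exact mem_iUnion.2 ⟨Nat.pair i j, by simpa using hj⟩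
  have J_empty : J ∅ := J_of (hP _ subsingleton_empty)
  have J_union : ∀ {E F : Set A}, J E → J F → J (E ∪ F) := by
    intro E F hE hF
    refine J_mono ?_ (J_iUnion (fun n => if n = 0 then E else F) (fun n => by
      by_cases h : n = 0 <;> simp [h, hE, hF]))
    rintro a (ha | ha)
    · exact mem_iUnion.2 ⟨0, by simpa using ha⟩
    · exact mem_iUnion.2 ⟨1, by simpa using ha⟩
  have J_finite : ∀ {F : Set A}, F.Finite → J F := by
    intro F hF
    induction F, hF using Set.Finite.induction_on with
    | empty => exact J_empty
    | @insert a s _ _ ih => exact J_union (J_of (hP _ (subsingleton_singleton (a := a)))) ih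
  by_contra hcon
  have J_univ : ¬ J univ := fun ⟨c, hc, hcP⟩ =>
    hcon ⟨c, fun a => mem_iUnion.1 (hc (mem_univ a)), hcP⟩
  have split : ∀ E : {E : Set A // ¬ J E}, ∃ S : Set A, S ⊆ E.1 ∧ ¬ J S ∧ ¬ J (E.1 \ S) := by
    rintro ⟨E, hE⟩
    by_contra! h
    let F : Filter A :=
      { sets := {S | J (E \ S)}
        univ_sets := by simpa using J_empty
        sets_of_superset := fun hS hST => J_mono (sdiff_subset_sdiff_right hST) hS
        inter_sets := fun {S T} hS hT => by
          change J (E \ (S ∩ T))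
          rw [sdiff_inter]
          exact J_union hS hT }
    let p : Ultrafilter A := Ultrafilter.ofComplNotMemIff F (fun S => by
      change ¬ J (E \ Sᶜ) ↔ J (E \ S)
      rw [sdiff_compl]
      constructor
      · intro hS
        simpa using h (E ∩ S) inter_subset_left hS
      · intro hS hS'
        exact hE (by simpa using J_union hS' hS))
    have hp : ∀ S, S ∈ p ↔ J (E \ S) := fun S => Iff.rfl
    refine hA ⟨p, fun S hS hSp => ?_, fun S hS => ?_⟩
    · refine hE (J_mono ?_ (J_union ((hp S).1 hSp) (J_finite hS)))
      rw [sdiff_union_self]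
      exact subset_union_left
    · rw [hp, sdiff_iInter]
      exact J_iUnion _ fun n => (hp _).1 (hS n)
  choose s hsE hs hEs using split
  let e : ℕ → {E : Set A // ¬ J E} := fun n =>
    Nat.rec ⟨univ, J_univ⟩ (fun _ E => ⟨E.1 \ s E, hEs E⟩) n
  have he : ∀ n, (e (n + 1)).1 = (e n).1 \ s (e n) := fun n => rfl
  have hanti : Antitone fun n => (e n).1 := antitone_nat_of_succ_le fun n => by
    rw [he]; exact sdiff_subset
  have hd : ∀ m n, m < n → Disjoint (s (e m)) (s (e n)) := by
    intro m n hmn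
    rw [Set.disjoint_left]
    intro a ha ha'
    have := hanti (Nat.succ_le_of_lt hmn) (hsE _ ha')
    exact this.2 ha
  obtain ⟨n, hn⟩ := hdisj (fun n => s (e n)) (fun m n hmn => by
    rcases lt_or_gt_of_ne hmn with h | h
    · exact hd m n h
    · exact (hd n m h).symm)
  exact hs _ (J_of hn)

/-- The power set of a second countable T₁ space contains a countable family that is dense in the
Cantor cube. -/
theorem exists_countable_dense_family (K : Type*) [TopologicalSpace K] [SecondCountableTopology K]
    [T1Space K] : ∃ C : Set (Set K), C.Countable ∧
      ∀ F J : Finset K, ∃ T ∈ C, ∀ k ∈ J, (k ∈ T ↔ k ∈ F) := by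
  classical
  have hB := TopologicalSpace.isBasis_countableBasis K
  refine ⟨sUnion '' {s | s.Finite ∧ s ⊆ TopologicalSpace.countableBasis K},
    (countable_ofPred_finite_subset (TopologicalSpace.countable_countableBasis K)).image _, ?_⟩
  intro F J
  have hU : IsOpen ((J \ F : Finset K) : Set K)ᶜ := (Finset.finite_toSet _).isClosed.isOpen_compl
  have h : ∀ x : F, ∃ b ∈ TopologicalSpace.countableBasis K,
      x.1 ∈ b ∧ b ⊆ ((J \ F : Finset K) : Set K)ᶜ := fun x =>
    hB.exists_subset_of_mem_open (by simp) hU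
  choose b hb hxb hbU using h
  refine ⟨⋃₀ range b, ⟨range b, ⟨finite_range b, range_subset_iff.2 hb⟩, rfl⟩, ?_⟩
  intro k hk
  constructor
  · rintro ⟨_, ⟨x, rfl⟩, hkx⟩
    have := hbU x hkx
    by_contra hkF
    exact this (by simp [hk, hkF])
  · intro hkF
    exact ⟨b ⟨k, hkF⟩, mem_range_self _, hxb ⟨k, hkF⟩⟩

namespace OmegaContinuousSetFun

/-- On a second countable T₁ space, the value at the whole space is approximated by values at
finite sets. -/
theorem exists_finset_abs_sub_lt {K : Type*} [TopologicalSpace K] [SecondCountableTopology K]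
    [T1Space K] {g : Set K → ℝ} (hg : OmegaContinuousSetFun g) {δ : ℝ} (hδ : 0 < δ) :
    ∃ F : Finset K, |g F - g univ| < δ := by
  classical
  by_contra! h
  obtain ⟨C, hC, hdense⟩ := exists_countable_dense_family K
  have h1 : ∀ F : Finset K, ∃ T ∈ C, (F : Set K) ⊆ T ∧ δ / 2 ≤ |g T - g univ| := by
    intro F
    obtain ⟨T, ⟨hTC, hFT⟩, hT⟩ := hg.exists_abs_sub_lt (C := {T ∈ C | (F : Set K) ⊆ T})
      (hC.mono (sep_subset _ _)) (S := F) (fun J => by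
        obtain ⟨T, hTC, hT⟩ := hdense F (J ∪ F)
        exact ⟨T, ⟨hTC, fun k hk => (hT k (Finset.mem_union_right _ hk)).2 hk⟩,
          fun k hk => hT k (Finset.mem_union_left _ hk)⟩) (half_pos hδ)
    refine ⟨T, hTC, hFT, ?_⟩
    have h2 := h F
    have h3 := abs_sub_le (g F) (g T) (g univ)
    rw [abs_sub_comm (g F) (g T)] at h3
    linarith
  obtain ⟨T, ⟨-, hT⟩, hT'⟩ := hg.exists_abs_sub_lt (C := {T ∈ C | δ / 2 ≤ |g T - g univ|})
    (hC.mono (sep_subset _ _)) (S := univ) (fun J => by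
      obtain ⟨T, hTC, hJT, hT⟩ := h1 J
      exact ⟨T, ⟨hTC, hT⟩, fun k hk => by simp [hJT hk]⟩) (half_pos hδ)
  exact absurd hT' hT.not_gt

/-- On a set of non-Ulam-measurable cardinality, the value at the whole set is approximated by
values at finite sets. -/
theorem exists_finite_abs_sub_lt {A : Type*} (hA : ¬ UlamMeasurableType A) {g : Set A → ℝ}
    (hg : OmegaContinuousSetFun g) {δ : ℝ} (hδ : 0 < δ) :
    ∃ S : Set A, S.Finite ∧ |g S - g univ| < δ := by
  classical
  have hcover : ∀ k : ℕ, ∃ c : ℕ → Set A, (∀ a, ∃ n, a ∈ c n) ∧ ∀ n, ((c n).Subsingleton ∨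
      ∀ T T' : Set A, (∀ a ∉ c n, (a ∈ T ↔ a ∈ T')) → |g T - g T'| ≤ 1 / ((k : ℝ) + 1)) :=
    fun k => exists_countable_cover_of_not_ulamMeasurable hA (fun E => E.Subsingleton ∨
      ∀ T T' : Set A, (∀ a ∉ E, (a ∈ T ↔ a ∈ T')) → |g T - g T'| ≤ 1 / ((k : ℝ) + 1)) (fun S hS => Or.inl hS)
      (fun E hE => (hg.exists_small_of_disjoint Nat.one_div_pos_of_nat E hE).imp
        fun n hn => Or.inr hn)
  choose c hc hcP using hcover
  choose φ hφ using hc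
  let ψ : A → ℕ → ℕ := fun a k => φ k a
  have hfib : ∀ κ : ℕ → ℕ, (ψ ⁻¹' {κ}).Finite ∨
      ∀ T T' : Set A, (∀ a ∉ ψ ⁻¹' {κ}, (a ∈ T ↔ a ∈ T')) → g T = g T' := by
    intro κ
    have hsub : ∀ k, ψ ⁻¹' {κ} ⊆ c k (κ k) := by
      rintro k a rfl
      exact hφ k a
    by_cases h : ∃ k, (c k (κ k)).Subsingleton
    · obtain ⟨k, hk⟩ := h
      exact Or.inl (hk.anti (hsub k)).finite
    · push Not at h
      refine Or.inr fun T T' hT => ?_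
      have hle : ∀ k : ℕ, |g T - g T'| ≤ 1 / ((k : ℝ) + 1) := fun k =>
        (hcP k (κ k)).resolve_left (Set.not_subsingleton_iff.2 (h k)) T T'
          fun a ha => hT a fun h' => ha (hsub k h')
      have h0 : |g T - g T'| ≤ 0 :=
        ge_of_tendsto' tendsto_one_div_add_atTop_nhds_zero_nat hle
      exact sub_eq_zero.1 (abs_nonpos_iff.1 h0)
  have hfin : ∀ F : Finset (ℕ → ℕ), ∃ S : Set A, S.Finite ∧
      ∀ T, g (ψ ⁻¹' F ∪ T) = g (S ∪ T) := by
    intro F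
    induction F using Finset.induction_on with
    | empty => exact ⟨∅, finite_empty, fun T => by simp⟩
    | insert κ F _ ih =>
      obtain ⟨S, hS, hST⟩ := ih
      have h1 : ∀ T, g (ψ ⁻¹' (insert κ F : Finset (ℕ → ℕ)) ∪ T) = g (S ∪ (ψ ⁻¹' {κ} ∪ T)) := by
        intro T
        rw [← hST, Finset.coe_insert, insert_eq, preimage_union, union_assoc,
          union_left_comm]
      rcases hfib κ with h | h
      · exact ⟨S ∪ ψ ⁻¹' {κ}, hS.union h, fun T => by rw [h1, union_assoc]⟩
      · refine ⟨S, hS, fun T => ?_⟩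
        rw [h1]
        refine h _ _ fun a ha => ?_
        simp only [mem_union, ha, false_or]
  obtain ⟨F, hF⟩ := (hg.comp_preimage ψ).exists_finset_abs_sub_lt hδ
  obtain ⟨S, hS, hST⟩ := hfin F
  refine ⟨S, hS, ?_⟩
  have h2 := hST ∅
  rw [union_empty, union_empty] at h2
  simpa [← h2] using hF

end OmegaContinuousSetFun

theorem Set.Countable.setOf_finset_subset {I : Type*} {D : Set I} (hD : D.Countable) :
    {s : Finset I | (s : Set I) ⊆ D}.Countable :=
  ((countable_ofPred_finite_subset hD).preimage_of_injOn
    (f := fun s : Finset I => (s : Set I)) Finset.coe_injective.injOn).mono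
    fun s (hs : (s : Set I) ⊆ D) =>
      show (s : Set I) ∈ {t : Set I | t.Finite ∧ t ⊆ D} from ⟨s.finite_toSet, hs⟩

/-- If every finite set of indices determines a countable set of indices, then some countable set
of indices is closed under this operation. -/
theorem exists_countable_closed {I : Type*} (Φ : Finset I → Set I) (hΦ : ∀ s, (Φ s).Countable) :
    ∃ D : Set I, D.Countable ∧ ∀ s : Finset I, (s : Set I) ⊆ D → Φ s ⊆ D := by
  let d : ℕ → Set I := fun n =>
    Nat.rec ∅ (fun _ D => D ∪ ⋃ s ∈ {s : Finset I | (s : Set I) ⊆ D}, Φ s) n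
  have hd : ∀ n, d (n + 1) = d n ∪ ⋃ s ∈ {s : Finset I | (s : Set I) ⊆ d n}, Φ s := fun n => rfl
  have hmono : Monotone d := monotone_nat_of_le_succ fun n => by
    rw [hd]; exact subset_union_left
  have hcount : ∀ n, (d n).Countable := by
    intro n
    induction n with
    | zero => exact countable_empty
    | succ n ih =>
      rw [hd]
      exact ih.union (ih.setOf_finset_subset.biUnion fun s _ => hΦ s)
  refine ⟨⋃ n, d n, countable_iUnion hcount, fun s hs => ?_⟩
  obtain ⟨n, hn⟩ := (directed_of_isDirected_le hmono).exists_mem_subset_of_finset_subset_biUnion hs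
  refine Subset.trans ?_ (subset_iUnion d (n + 1))
  rw [hd]
  exact (subset_biUnion_of_mem (u := Φ) (show s ∈ {s : Finset I | (s : Set I) ⊆ d n} from hn)).trans
    subset_union_right

/-- Σ-products of bi-sequential spaces are countably tight at their base point. -/
theorem exists_countable_subset_mem_closure_pi {A : Type*} {X : A → Type*}
    [∀ a, TopologicalSpace (X a)] (hX : ∀ a, BiSequential (X a)) {x : ∀ a, X a}
    {B : Set (∀ a, X a)} (hB : ∀ y ∈ B, {a | y a ≠ x a}.Countable) (hx : x ∈ closure B) :
    ∃ C ⊆ B, C.Countable ∧ x ∈ closure C := by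
  classical
  obtain ⟨𝒰, hBU, hUx⟩ := mem_closure_iff_ultrafilter.1 hx
  have h : ∀ a, ∃ V : ℕ → Set (X a), (∀ n, Function.eval a ⁻¹' V n ∈ 𝒰) ∧
      ∀ W ∈ 𝓝 (x a), ∃ n, V n ⊆ W := by
    intro a
    obtain ⟨F, hF, hUF, hFx⟩ := hX a (x a) (𝒰.map (Function.eval a))
      ((continuous_apply a).continuousAt.tendsto.mono_left hUx)
    obtain ⟨V, hV⟩ := F.exists_antitone_basis
    exact ⟨V, fun n => hUF (hV.mem n), fun W hW => hV.mem_iff.1 (hFx hW)⟩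
  choose V hVU hVx using h
  have hpt : ∀ s : Finset (A × ℕ), ∃ y ∈ B, ∀ i ∈ s, y i.1 ∈ V i.1 i.2 := by
    intro s
    have h1 : (⋂ i ∈ s, Function.eval i.1 ⁻¹' V i.1 i.2) ∈ (𝒰 : Filter (∀ a, X a)) :=
      (biInter_finset_mem s).2 fun i _ => hVU i.1 i.2
    obtain ⟨y, hyB, hy⟩ := 𝒰.nonempty_of_mem (inter_mem hBU h1)
    exact ⟨y, hyB, fun i hi => by simpa using mem_iInter₂.1 hy i hi⟩
  choose y hyB hy using hpt
  obtain ⟨D, hD, hDcl⟩ := exists_countable_closed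
    (fun s => {a | y s a ≠ x a} ×ˢ (univ : Set ℕ)) fun s => (hB _ (hyB s)).prod countable_univ
  refine ⟨y '' {s | (s : Set (A × ℕ)) ⊆ D}, ?_, ?_, ?_⟩
  · rintro _ ⟨s, -, rfl⟩
    exact hyB s
  · exact hD.setOf_finset_subset.image y
  · rw [mem_closure_iff_nhds]
    intro U hU
    rw [nhds_pi, Filter.mem_pi] at hU
    obtain ⟨I, hI, W, hW, hWU⟩ := hU
    choose n hn using fun a => hVx a (W a) (hW a)
    let s : Finset (A × ℕ) := (hI.toFinset.image fun a => (a, n a)).filter (· ∈ D)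
    have hsD : (s : Set (A × ℕ)) ⊆ D := fun i hi => (Finset.mem_filter.1 hi).2
    refine ⟨y s, hWU fun a ha => ?_, ⟨s, hsD, rfl⟩⟩
    by_cases hya : y s a = x a
    · rw [hya]
      exact mem_of_mem_nhds (hW a)
    · have haD : (a, n a) ∈ D := hDcl s hsD ⟨hya, mem_univ _⟩
      exact hn a (hy s (a, n a) (Finset.mem_filter.2
        ⟨Finset.mem_image.2 ⟨a, hI.mem_toFinset.2 ha, rfl⟩, haD⟩))

open Classical in
/-- Mixing two points of a product along a set of indices turns an ω-continuous function into an
ω-continuous set function. -/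
theorem omegaContinuousSetFun_piecewise {A : Type*} {X : A → Type*}
    [∀ a, TopologicalSpace (X a)] {f : (∀ a, X a) → ℝ}
    (hf : ∀ S : Set (∀ a, X a), S.Countable → Continuous fun x : S => f x) (x y : ∀ a, X a) :
    OmegaContinuousSetFun fun S : Set A => f (S.piecewise y x) := by
  intro p C S hC hCp hS
  let m : Set A → ∀ a, X a := fun T => T.piecewise y x
  have h : map m p ≤ 𝓝 (m S) := by
    refine tendsto_pi_nhds.2 fun a => tendsto_nhds_of_eventually_eq ?_
    filter_upwards [hS a] with T hT
    by_cases ha : a ∈ S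
    · simp [m, ha, hT.2 ha]
    · simp [m, ha, mt hT.1 ha]
  exact tendsto_map'_iff.1 (tendsto_of_countable_mem hf (hC.image m) (image_mem_map hCp) h)

/-- a product of bi-sequential spaces over an index set of non-Ulam-measurable
cardinality has countable functional tightness. -/
theorem countableFunctionalTightness_pi {A : Type u} (X : A → Type u)
    [∀ a, TopologicalSpace (X a)] (hX : ∀ a, BiSequential (X a))
    (hA : ¬ UlamMeasurableType A) :
    CountableFunctionalTightness (∀ a, X a) := by
  classical
  intro f hf
  refine continuous_iff_continuousAt.2 fun x => Metric.tendsto_nhds.2 fun ε hε => ?_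
  by_contra hcon
  let B : Set (∀ a, X a) := {z | {a | z a ≠ x a}.Finite ∧ ε / 2 ≤ dist (f z) (f x)}
  have hxB : x ∈ closure B := by
    rw [mem_closure_iff_nhds]
    intro U hU
    rw [nhds_pi, Filter.mem_pi] at hU
    obtain ⟨I, hI, W, hW, hWU⟩ := hU
    obtain ⟨y, hy, hyI⟩ := ((not_eventually.1 hcon).and_eventually
      (set_pi_mem_nhds hI fun a _ => hW a)).exists
    obtain ⟨S, hS, hSy⟩ :=
      (omegaContinuousSetFun_piecewise hf x y).exists_finite_abs_sub_lt hA (half_pos hε)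
    refine ⟨S.piecewise y x, hWU fun a ha => ?_, hS.subset fun a ha => ?_, ?_⟩
    · by_cases haS : a ∈ S
      · simpa [haS] using hyI a ha
      · simpa [haS] using mem_of_mem_nhds (hW a)
    · by_contra haS
      exact ha (by simp [haS])
    · rw [piecewise_univ, ← Real.dist_eq] at hSy
      have h1 := dist_triangle_left (f y) (f x) (f (S.piecewise y x))
      linarith [not_lt.1 hy]
  obtain ⟨C, hCB, hC, hxC⟩ :=
    exists_countable_subset_mem_closure_pi hX (fun z hz => hz.1.countable) hxB
  have : (𝓝[C] x).NeBot := mem_closure_iff_nhdsWithin_neBot.1 hxC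
  have h := tendsto_of_countable_mem hf (x := x) (p := 𝓝[C] x) hC
    self_mem_nhdsWithin nhdsWithin_le_nhds
  obtain ⟨z, hz, hzC⟩ :=
    ((Metric.tendsto_nhds.1 h (ε / 2) (half_pos hε)).and self_mem_nhdsWithin).exists
  exact absurd hz (hCB hzC).2.not_gt
end

section
/- Let {X_α : α ∈ A} be a family of bi-sequential topological spaces and let X = ∏_{α ∈ A} X_α with the product topology. If the cardinal Card(A) is non-sequential, then X is f-sequential: every sequentially continuous function f : X → ℝ is continuous. -/
open Filter Topology Set

universe u

/-- A topological space `X` is f-sequential if every sequentially continuous real-valued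
function on `X` is continuous. -/
def FSequential (X : Type*) [TopologicalSpace X] : Prop :=
  ∀ f : X → ℝ, SeqContinuous f → Continuous f

/-- `Card(A)` is a sequential cardinal: the Cantor cube `2^A` (here `A → Bool` with the
product of discrete topologies) is not f-sequential, i.e. it admits a sequentially
continuous real-valued function that is not continuous. -/
def SequentialCard (A : Type*) : Prop :=
  ∃ f : (A → Bool) → ℝ, SeqContinuous f ∧ ¬ Continuous f

/-- The piecewise combinations of `x` and `y`, indexed by the points of the Cantor cube,
depend continuously on the index. -/
theorem continuous_ite_pi {A : Type*} {X : A → Type*} [∀ a, TopologicalSpace (X a)]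
    (x y : ∀ a, X a) :
    Continuous fun (c : A → Bool) (a : A) => if c a = true then y a else x a :=
  continuous_pi fun a =>
    (continuous_of_discreteTopology (f := fun b : Bool => if b = true then y a else x a)).comp
      (continuous_apply a)

open Classical in
/-- The indicator functions of finite sets converge to the constant function `true` in the
Cantor cube. -/
theorem tendsto_decide_mem_finset (A : Type*) :
    Tendsto (fun (S : Finset A) (a : A) => decide (a ∈ S)) atTop (𝓝 fun _ => true) := by
  refine tendsto_pi_nhds.2 fun a => tendsto_const_nhds.congr' ?_
  filter_upwards [eventually_ge_atTop {a}] with S hS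
  simpa using hS

/-- In a product of bi-sequential spaces, if `x` is in the closure of a set of points that differ
from `x` at finitely many coordinates only, then it is the limit of a sequence in this set. -/
theorem exists_seq_tendsto_of_mem_closure_pi {A : Type*} {X : A → Type*}
    [∀ a, TopologicalSpace (X a)] (hX : ∀ a, BiSequential (X a)) {x : ∀ a, X a}
    {E : Set (∀ a, X a)} (hE : ∀ y ∈ E, ∃ S : Finset A, ∀ a ∉ S, y a = x a)
    (hx : x ∈ closure E) :
    ∃ y : ℕ → ∀ a, X a, (∀ n, y n ∈ E) ∧ Tendsto y atTop (𝓝 x) := by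
  classical
  obtain ⟨𝒰, hE𝒰, h𝒰⟩ := mem_closure_iff_ultrafilter.1 hx
  have hbasis : ∀ a, ∃ B : ℕ → Set (X a),
      (∀ n, ∀ᶠ y in (𝒰 : Filter (∀ a, X a)), y a ∈ B n) ∧
        ∀ s ∈ 𝓝 (x a), ∃ n, ∀ m ≥ n, B m ⊆ s := by
    intro a
    obtain ⟨F, hF, h𝒰F, hFx⟩ := hX a (x a) (𝒰.map fun y : ∀ a, X a => y a)
      (((continuous_apply a).tendsto x).mono_left h𝒰)
    obtain ⟨B, hB⟩ := F.exists_antitone_basis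
    refine ⟨B, fun n => h𝒰F (hB.mem n), fun s hs => ?_⟩
    obtain ⟨n, hn⟩ := hB.mem_iff.1 (hFx hs)
    exact ⟨n, fun m hm => (hB.antitone hm).trans hn⟩
  choose B hB𝒰 hBx using hbasis
  have hstep : ∀ (T : Finset A) (n : ℕ), ∃ y ∈ E, ∀ a ∈ T, y a ∈ B a n := fun T n =>
    (((T.eventually_all).2 fun a _ => hB𝒰 a n).and hE𝒰).exists.imp fun _ h => ⟨h.2, h.1⟩
  choose Y hYE hYB using hstep
  choose! S hS using hE
  let T : ℕ → Finset A := fun n => Nat.rec ∅ (fun n T => T ∪ S (Y T n)) n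
  have hTsucc : ∀ n, T (n + 1) = T n ∪ S (Y (T n) n) := fun _ => rfl
  have hTmono : Monotone T :=
    monotone_nat_of_le_succ fun n => (hTsucc n).symm ▸ Finset.subset_union_left
  refine ⟨fun n => Y (T n) n, fun n => hYE _ _, tendsto_pi_nhds.2 fun a => ?_⟩
  rcases em (∃ k, a ∈ T k) with ⟨k, hk⟩ | ha
  · intro s hs
    obtain ⟨n, hn⟩ := hBx a s hs
    change ∀ᶠ m in atTop, Y (T m) m a ∈ s
    filter_upwards [eventually_ge_atTop k, eventually_ge_atTop n] with m hkm hnm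
    exact hn m hnm (hYB _ _ _ (hTmono hkm hk))
  · refine tendsto_const_nhds.congr fun n => (hS _ (hYE _ _) a fun h => ha ⟨n + 1, ?_⟩).symm
    rw [hTsucc]
    exact Finset.mem_union_right _ h

/-- a product of bi-sequential spaces over an index set whose cardinal is not
sequential is f-sequential: every sequentially continuous real-valued function on the
product is continuous. -/
theorem fSequential_pi {A : Type u} (X : A → Type u) [∀ a, TopologicalSpace (X a)]
    (hX : ∀ a, BiSequential (X a)) (hA : ¬ SequentialCard A) :
    FSequential (∀ a, X a) := by
  classical
  intro f hf
  refine continuous_iff_continuousAt.2 fun x => Metric.tendsto_nhds.2 fun ε hε => ?_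
  by_contra hfar
  let E : Set (∀ a, X a) :=
    {y | (∃ S : Finset A, ∀ a ∉ S, y a = x a) ∧ ε / 2 < dist (f y) (f x)}
  have hclosure : {y | ¬ dist (f y) (f x) < ε} ⊆ closure E := by
    intro y hy
    let p : (A → Bool) → ∀ a, X a := fun c a => if c a = true then y a else x a
    have hp : Continuous p := continuous_ite_pi x y
    have hfp : Continuous (f ∘ p) := by
      by_contra hdisc
      exact hA ⟨f ∘ p, fun _ _ h => hf (hp.seqContinuous h), hdisc⟩
    have hptop : p (fun _ => true) = y := by simp [p]
    have hlim := (hp.tendsto _).comp (tendsto_decide_mem_finset A)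
    have hflim := (hfp.tendsto _).comp (tendsto_decide_mem_finset A)
    rw [hptop] at hlim
    rw [Function.comp_apply, hptop] at hflim
    refine mem_closure_of_tendsto hlim ?_
    have hy' : ε / 2 < dist (f y) (f x) := (half_lt_self hε).trans_le (not_lt.1 hy)
    filter_upwards [(hflim.dist tendsto_const_nhds).eventually_const_lt hy'] with S hS
    exact ⟨⟨S, fun a ha => by simp [p, ha]⟩, hS⟩
  have hx : x ∈ closure E :=
    closure_minimal hclosure isClosed_closure (mem_closure_iff_frequently.2 (not_eventually.1 hfar))
  obtain ⟨y, hyE, hyx⟩ := exists_seq_tendsto_of_mem_closure_pi hX (fun y hy => hy.1) hx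
  obtain ⟨n, hn⟩ := ((Metric.tendsto_nhds.1 (hf hyx)) (ε / 2) (half_pos hε)).exists
  exact lt_asymm hn (hyE n).2
end
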